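/- arXiv:1806.07799 — 3 statements merged into one kernel-verified Lean document; each statement's English description precedes it below -/
import Mathlib

section
/- The map T is transitive: for all x and y in (ZMod p_1) × ⋯ × (ZMod p_k) there exists a natural number n such that the n-th iterate of T sends x to y. -/
/-- Let `p₁, …, p_k` be pairwise coprime odd positive integers and `p ≥ 1`.
The map `T` on `(ZMod p₁) × ⋯ × (ZMod p_k)` defined by
`T(x)_j = x_j + 4^((2^k − 2^j)·p)` (coordinates indexed by `j = 1, …, k`)
is transitive: for all `x, y` there is `n : ℕ` with `T^[n] x = y`. -/
theorem T_transitive (k p : ℕ) (hk : 1 ≤ k) (hp : 1 ≤ p)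
    (m : Fin k → ℕ) (hmpos : ∀ j, 0 < m j) (hmodd : ∀ j, Odd (m j))
    (hcop : ∀ i j, i ≠ j → Nat.Coprime (m i) (m j))
    (T : (∀ j, ZMod (m j)) → (∀ j, ZMod (m j)))
    (hT : ∀ x j, T x j = x j + (4 : ZMod (m j)) ^ ((2 ^ k - 2 ^ ((j : ℕ) + 1)) * p)) :
    ∀ x y : ∀ j, ZMod (m j), ∃ n : ℕ, T^[n] x = y := by
  intro x y
  have hunit (j : Fin k) :
      IsUnit ((4 : ZMod (m j)) ^ ((2 ^ k - 2 ^ ((j : ℕ) + 1)) * p)) := by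
    have h4 : Nat.Coprime 4 (m j) := (Nat.coprime_two_left.2 (hmodd j)).pow_left 2
    exact ((ZMod.isUnit_iff_coprime 4 (m j)).2 h4).pow _
  choose u hu using hunit
  have iterate_apply (n : ℕ) (j : Fin k) : T^[n] x j = x j + n * (u j : ZMod (m j)) := by
    induction n with
    | zero => simp
    | succ n ih => rw [Function.iterate_succ_apply', hT, ih, ← hu]; push_cast; ring
  let e := ZMod.prodEquivPi m fun i j hij => hcop i j hij
  have : NeZero (∏ j, m j) := ⟨Finset.prod_ne_zero_iff.2 fun j _ => (hmpos j).ne'⟩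
  obtain ⟨n, hn⟩ :=
    ZMod.natCast_zmod_surjective (e.symm fun j => (y j - x j) * ((u j)⁻¹ : (ZMod (m j))ˣ))
  refine ⟨n, funext fun j => ?_⟩
  have hnj : (n : ZMod (m j)) = (y j - x j) * ((u j)⁻¹ : (ZMod (m j))ˣ) := by
    have h := congrFun (congrArg e hn) j
    rwa [map_natCast, e.apply_symm_apply] at h
  rw [iterate_apply, hnj, Units.inv_mul_cancel_right, add_sub_cancel]
end

section
/- For every x in (ZMod p_1) × ⋯ × (ZMod p_k), the least positive integer n such that the n-th iterate of T fixes x is exactly the product p_1 · p_2 ⋯ p_k. -/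
theorem iterate_apply_of_forall_add_const {ι : Type*} {G : ι → Type*}
    [∀ j, AddMonoid (G j)] {T : (∀ j, G j) → (∀ j, G j)} {c : ∀ j, G j}
    (hT : ∀ x j, T x j = x j + c j) (n : ℕ) (x : ∀ j, G j) (j : ι) :
    T^[n] x j = x j + n • c j := by
  induction n with
  | zero => simp
  | succ n ih => rw [Function.iterate_succ_apply', hT, ih, succ_nsmul, add_assoc]

theorem ZMod.isUnit_four_of_odd {n : ℕ} (hn : Odd n) : IsUnit (4 : ZMod n) := by
  have h : Nat.Coprime (2 ^ 2) n := (Nat.coprime_two_left.mpr hn).pow_left 2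
  exact_mod_cast (ZMod.isUnit_iff_coprime (2 ^ 2) n).mpr h

/-- Let `p₁, …, p_k` be pairwise coprime odd positive integers and `p ≥ 1`.
For the map `T(x)_j = x_j + 4^((2^k − 2^j)·p)` on `(ZMod p₁) × ⋯ × (ZMod p_k)`,
the least positive `n` with `T^[n] x = x` is exactly `p₁ ⋯ p_k`, for every `x`. -/
theorem T_least_period (k p : ℕ) (hk : 1 ≤ k) (hp : 1 ≤ p)
    (m : Fin k → ℕ) (hmpos : ∀ j, 0 < m j) (hmodd : ∀ j, Odd (m j))
    (hcop : ∀ i j, i ≠ j → Nat.Coprime (m i) (m j))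
    (T : (∀ j, ZMod (m j)) → (∀ j, ZMod (m j)))
    (hT : ∀ x j, T x j = x j + (4 : ZMod (m j)) ^ ((2 ^ k - 2 ^ ((j : ℕ) + 1)) * p)) :
    ∀ x : ∀ j, ZMod (m j),
      IsLeast {n : ℕ | 0 < n ∧ T^[n] x = x} (∏ j, m j) := by
  intro x
  have fixed_iff (n : ℕ) : T^[n] x = x ↔ ∀ j, m j ∣ n := by
    rw [funext_iff]
    refine forall_congr' fun j ↦ ?_
    rw [iterate_apply_of_forall_add_const hT, add_eq_left, nsmul_eq_mul,
      ((ZMod.isUnit_four_of_odd (hmodd j)).pow _).mul_left_eq_zero,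
      ZMod.natCast_eq_zero_iff]
  refine ⟨⟨Finset.prod_pos fun j _ ↦ hmpos j,
    (fixed_iff _).mpr fun j ↦ Finset.dvd_prod_of_mem m (Finset.mem_univ j)⟩, ?_⟩
  rintro n ⟨hn, hfix⟩
  exact Nat.le_of_dvd hn <| Fintype.prod_dvd_of_isRelPrime
    (fun i j hij ↦ Nat.coprime_iff_isRelPrime.mp (hcop i j hij)) ((fixed_iff n).mp hfix)
end

section
/- Let W be a minimal ℤ-subshift over A, let w ∈ W, let U ⊆ ℤ be a finite set and p : U → A a pattern such that p appears in w at position u, i.e., w(u + v) = p(v) for all v ∈ U. Then for every integer N > 0 there exists an integer t ≥ 1 such that p appears in w at position u + N·t, i.e., w(u + N·t + v) = p(v) for all v ∈ U. -/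
open Filter Topology in
theorem eventually_nhds_eqOn_finset {ι A : Type*} [TopologicalSpace A] [DiscreteTopology A]
    (F : Finset ι) (x : ι → A) : ∀ᶠ y in 𝓝 x, ∀ i ∈ F, y i = x i := by
  rw [eventually_all_finset]
  intro i _
  exact (continuous_apply i).continuousAt.eventually
    ((isOpen_discrete {x i}).mem_nhds (Set.mem_singleton _))

open Filter Topology in
/-- Every point of a minimal subshift is forward recurrent. -/
theorem exists_pos_shift_eqOn_of_minimal
    {A : Type*} [Finite A] [TopologicalSpace A] [DiscreteTopology A] {W : Set (ℤ → A)}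
    (hmin : ∀ w ∈ W, closure {y : ℤ → A | ∃ m : ℤ, y = fun n => w (n + m)} = W)
    {w : ℤ → A} (hw : w ∈ W) (F : Finset ℤ) :
    ∃ n : ℤ, 1 ≤ n ∧ ∀ v ∈ F, w (v + n) = w v := by
  have hWcl : IsClosed W := hmin w hw ▸ isClosed_closure
  have h_orbit (m : ℕ) : (fun n => w (n + (m : ℤ))) ∈ W := by
    rw [← hmin w hw]
    exact subset_closure ⟨m, rfl⟩
  obtain ⟨z, hzW, hz⟩ := hWcl.isCompact.exists_mapClusterPt_of_frequently
    (l := atTop) (Eventually.of_forall h_orbit).frequently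
  have hwz : w ∈ closure {y : ℤ → A | ∃ m : ℤ, y = fun n => z (n + m)} := by
    rwa [hmin z hzW]
  obtain ⟨_, hy, m, rfl⟩ := mem_closure_iff_nhds.1 hwz _ (eventually_nhds_eqOn_finset F w)
  obtain ⟨k, hk, hkm⟩ := ((hz.frequently
    (eventually_nhds_eqOn_finset (F.image (· + m)) z)).and_eventually
      (eventually_ge_atTop (1 - m).toNat)).exists
  refine ⟨m + k, by omega, fun v hv => ?_⟩
  rw [← add_assoc]
  exact (hk _ (Finset.mem_image_of_mem _ hv)).trans (hy v hv)

/-- If `w` returns to each of its finite windows, then arbitrarily many positions can be chosen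
all of whose positive differences are return times to a given window. -/
theorem exists_finset_differences_shift_eqOn {A : Type*} {w : ℤ → A}
    (hrec : ∀ F : Finset ℤ, ∃ n : ℤ, 1 ≤ n ∧ ∀ v ∈ F, w (v + n) = w v)
    (k : ℕ) (F : Finset ℤ) :
    ∃ S : Finset ℤ, S.card = k + 1 ∧ 0 ∈ S ∧ (∀ s ∈ S, 0 ≤ s) ∧
      ∀ a ∈ S, ∀ b ∈ S, a < b → ∀ v ∈ F, w (v + (b - a)) = w v := by
  induction k generalizing F with
  | zero => exact ⟨{0}, by simp⟩
  | succ k ih =>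
    obtain ⟨n, hn, hnF⟩ := hrec F
    obtain ⟨S, hcard, h0, hnonneg, hS⟩ := ih (F ∪ F.image (· + n))
    refine ⟨insert 0 (S.image (n + ·)), ?_, Finset.mem_insert_self _ _, ?_, ?_⟩
    · rw [Finset.card_insert_of_notMem, Finset.card_image_of_injective _ (add_right_injective n),
        hcard]
      simp only [Finset.mem_image, not_exists, not_and]
      intro s hs
      have := hnonneg s hs
      omega
    · simp only [Finset.mem_insert, Finset.mem_image]
      rintro _ (rfl | ⟨s, hs, rfl⟩)
      · rfl
      · have := hnonneg s hs
        omega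
    · simp only [Finset.mem_insert, Finset.mem_image]
      rintro _ (rfl | ⟨a, ha, rfl⟩) _ (rfl | ⟨b, hb, rfl⟩) hab v hv
      · exact absurd hab (lt_irrefl _)
      · rw [sub_zero, ← add_assoc, ← hnF v hv]
        rcases (hnonneg b hb).eq_or_lt with rfl | hpos
        · rw [add_zero]
        · simpa using hS 0 h0 b hb hpos (v + n)
            (Finset.mem_union_right _ (Finset.mem_image_of_mem _ hv))
      · have := hnonneg a ha
        omega
      · rw [add_sub_add_left_eq_sub]
        exact hS a ha b hb (by omega) v (Finset.mem_union_left _ hv)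

/-- Let `W` be a minimal ℤ-subshift over a nonempty finite alphabet `A`,
`w ∈ W`, and `p : U → A` a pattern on a finite set `U ⊆ ℤ` appearing in `w`
at position `u`. Then for every integer `N > 0` there is an integer `t ≥ 1`
such that `p` appears in `w` at position `u + N·t`. -/
theorem minimal_subshift_pattern_recurrence
    {A : Type*} [Finite A] [Nonempty A] [TopologicalSpace A] [DiscreteTopology A]
    (W : Set (ℤ → A)) (hWne : W.Nonempty) (hWcl : IsClosed W)
    (hWinv : (fun x : ℤ → A => fun n => x (n + 1)) '' W = W)
    (hmin : ∀ w ∈ W, closure {y : ℤ → A | ∃ m : ℤ, y = fun n => w (n + m)} = W)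
    (w : ℤ → A) (hw : w ∈ W)
    (U : Set ℤ) (hU : U.Finite) (p : ℤ → A) (u : ℤ)
    (happ : ∀ v ∈ U, w (u + v) = p v) :
    ∀ N : ℤ, 0 < N → ∃ t : ℤ, 1 ≤ t ∧ ∀ v ∈ U, w (u + N * t + v) = p v := by
  intro N hN
  obtain ⟨S, hcard, -, -, hS⟩ := exists_finset_differences_shift_eqOn
    (exists_pos_shift_eqOn_of_minimal hmin hw) N.toNat (hU.toFinset.image (u + ·))
  obtain ⟨a, ha, b, hb, hne, hmod⟩ := Finset.exists_ne_map_eq_of_card_lt_of_maps_to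
    (s := S) (t := Finset.Ico 0 N) (f := (· % N)) (by rw [hcard, Int.card_Ico]; omega)
    (fun s _ => Finset.mem_coe.2 (Finset.mem_Ico.2
      ⟨Int.emod_nonneg s hN.ne', Int.emod_lt_of_pos s hN⟩))
  wlog hab : a < b generalizing a b
  · exact this b hb a ha hne.symm hmod.symm (by omega)
  obtain ⟨t, ht⟩ := Int.ModEq.dvd hmod
  refine ⟨t, by by_contra!; nlinarith, fun v hv => ?_⟩
  rw [← happ v hv, ← ht, add_right_comm]
  exact hS a ha b hb hab (u + v) (Finset.mem_image_of_mem _ (hU.mem_toFinset.2 hv))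
end
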